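/- For every pair of bits q₁, q₅ ∈ {0,1}, every middle string A = (0, A₁, A₀) with A₁, A₀ ∈ {0,1}, every x⃗=(x₁,x₂,x₃) ∈ {0,1}³ of even Hamming weight, every sign s ∈ {+1,−1}, and all bits i,j,k ∈ {0,1} with i+j+k even, the 5-qubit vector v_{A,x⃗,s} satisfies (X ⊗ P_i ⊗ P_j ⊗ P_k ⊗ I) v_{A,x⃗,s} = s · (−1)^{x₂} · (√−1)^{i+j+k} · (−1)^{j A₁ + k A₀} · v_{A,x⃗,s}. (The sign (−1)^{x₂} reproduces exactly the four cases x⃗ = (0,0,0), (1,0,1), (0,1,1), (1,1,0) listed in the paper, with signs +, +, −, − respectively.) -/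

import Mathlib

open Matrix Complex

noncomputable section

/-- Single-qubit Pauli X. -/
def Xg : Matrix (Fin 2) (Fin 2) ℂ := !![0, 1; 1, 0]
/-- Single-qubit Pauli Y. -/
def Yg : Matrix (Fin 2) (Fin 2) ℂ := !![0, -Complex.I; Complex.I, 0]
/-- Single-qubit Pauli Z. -/
def Zg : Matrix (Fin 2) (Fin 2) ℂ := !![1, 0; 0, -1]
/-- P₀ = X, P₁ = Y. -/
def Pg : Fin 2 → Matrix (Fin 2) (Fin 2) ℂ := fun i => if i = 0 then Xg else Yg

/-- Tensor (Kronecker) product of `n` single-qubit operators, as a matrix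
indexed by bit strings. -/
def tens {n : ℕ} (M : Fin n → Matrix (Fin 2) (Fin 2) ℂ) :
    Matrix (Fin n → Fin 2) (Fin n → Fin 2) ℂ :=
  Matrix.of fun r c => ∏ m, M m (r m) (c m)

/-- Computational basis vector |q⟩. -/
def ket {n : ℕ} (q : Fin n → Fin 2) : (Fin n → Fin 2) → ℂ :=
  fun r => if r = q then 1 else 0

/-- The eigenvector v_{A,x⃗,s} of the paper (5 qubits), with A = (0, A₁, A₀). -/
def vAx (q₁ q₅ A₁ A₀ x₁ x₂ x₃ : Fin 2) (s : ℂ) : (Fin 5 → Fin 2) → ℂ :=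
  (ket ![q₁, 0, A₁, A₀, q₅]
    + ((-1 : ℂ) ^ (x₁ : ℕ)) • ket ![q₁, 0, A₁, A₀, q₅+1]
    + ((-1 : ℂ) ^ (x₂ : ℕ)) • ket ![q₁+1, 0, A₁, A₀, q₅]
    + ((-1 : ℂ) ^ (x₃ : ℕ)) • ket ![q₁+1, 0, A₁, A₀, q₅+1])
  + s • (ket ![q₁, 1, A₁+1, A₀+1, q₅]
    + ((-1 : ℂ) ^ (x₁ : ℕ)) • ket ![q₁, 1, A₁+1, A₀+1, q₅+1]
    + ((-1 : ℂ) ^ (x₂ : ℕ)) • ket ![q₁+1, 1, A₁+1, A₀+1, q₅]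
    + ((-1 : ℂ) ^ (x₃ : ℕ)) • ket ![q₁+1, 1, A₁+1, A₀+1, q₅+1])

theorem tens_mulVec_ket {n : ℕ} (M : Fin n → Matrix (Fin 2) (Fin 2) ℂ) (p q : Fin n → Fin 2)
    (a : Fin n → ℂ) (h : ∀ m r, M m r (q m) = if r = p m then a m else 0) :
    (tens M).mulVec (ket q) = (∏ m, a m) • ket p := by
  ext r
  have hr : (tens M).mulVec (ket q) r = ∏ m, M m (r m) (q m) := by
    simp [Matrix.mulVec, dotProduct, tens, ket]
  rw [hr]
  by_cases hrp : r = p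
  · subst hrp
    simp [h, ket]
  · obtain ⟨m, hm⟩ := Function.ne_iff.mp hrp
    rw [Finset.prod_eq_zero (Finset.mem_univ m) (by rw [h, if_neg hm])]
    simp [ket, hrp]

theorem Pg_apply (i r c : Fin 2) :
    Pg i r c = if r = c + 1 then Complex.I ^ (i : ℕ) * (-1) ^ ((i : ℕ) * (c : ℕ)) else 0 := by
  fin_cases i <;> fin_cases r <;> fin_cases c <;> simp [Pg, Xg, Yg]

theorem tens_Xg_Pg_mulVec_ket (i j k a b c d e : Fin 2) :
    (tens ![Xg, Pg i, Pg j, Pg k, 1]).mulVec (ket ![a, b, c, d, e]) =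
      (Complex.I ^ ((i : ℕ) + (j : ℕ) + (k : ℕ)) *
        (-1 : ℂ) ^ ((i : ℕ) * (b : ℕ) + (j : ℕ) * (c : ℕ) + (k : ℕ) * (d : ℕ))) •
        ket ![a + 1, b + 1, c + 1, d + 1, e] := by
  rw [tens_mulVec_ket _ ![a + 1, b + 1, c + 1, d + 1, e] _
    ![1, Complex.I ^ (i : ℕ) * (-1) ^ ((i : ℕ) * (b : ℕ)),
      Complex.I ^ (j : ℕ) * (-1) ^ ((j : ℕ) * (c : ℕ)),
      Complex.I ^ (k : ℕ) * (-1) ^ ((k : ℕ) * (d : ℕ)), 1]]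
  · congr 1
    simp only [Fin.prod_univ_five, Matrix.cons_val]
    ring
  · intro m r
    fin_cases m
    · exact (Pg_apply 0 r a).trans (by simp only [Fin.val_zero, pow_zero, zero_mul, mul_one]; rfl)
    · exact Pg_apply i r b
    · exact Pg_apply j r c
    · exact Pg_apply k r d
    · exact Matrix.one_apply

theorem neg_one_pow_complement (i j k b c : Fin 2)
    (h : Even ((i : ℕ) + (j : ℕ) + (k : ℕ))) :
    (-1 : ℂ) ^ ((i : ℕ) * ((1 : Fin 2) : ℕ) + (j : ℕ) * ((b + 1 : Fin 2) : ℕ) +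
        (k : ℕ) * ((c + 1 : Fin 2) : ℕ)) =
      (-1) ^ ((j : ℕ) * (b : ℕ) + (k : ℕ) * (c : ℕ)) := by
  apply neg_one_pow_congr
  revert h
  revert i j k b c
  decide

theorem stmt17 (q₁ q₅ A₁ A₀ x₁ x₂ x₃ : Fin 2)
    (hx : Even ((x₁ : ℕ) + (x₂ : ℕ) + (x₃ : ℕ)))
    (s : ℂ) (hs : s = 1 ∨ s = -1)
    (i j k : Fin 2) (heven : Even ((i : ℕ) + (j : ℕ) + (k : ℕ))) :
    (tens ![Xg, Pg i, Pg j, Pg k, 1]).mulVec (vAx q₁ q₅ A₁ A₀ x₁ x₂ x₃ s) =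
      (s * (-1 : ℂ) ^ (x₂ : ℕ) * Complex.I ^ ((i : ℕ) + (j : ℕ) + (k : ℕ)) *
        (-1 : ℂ) ^ ((j : ℕ) * (A₁ : ℕ) + (k : ℕ) * (A₀ : ℕ))) •
        vAx q₁ q₅ A₁ A₀ x₁ x₂ x₃ s := by
  have hinv (a : Fin 2) : a + 1 + 1 = a := by revert a; decide
  have h11 : (1 + 1 : Fin 2) = 0 := rfl
  have hprod : (-1 : ℂ) ^ (x₁ : ℕ) = (-1) ^ (x₂ : ℕ) * (-1) ^ (x₃ : ℕ) := by
    rw [← pow_add]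
    apply neg_one_pow_congr
    rwa [add_assoc, Nat.even_add] at hx
  simp only [vAx, Matrix.mulVec_add, Matrix.mulVec_smul, tens_Xg_Pg_mulVec_ket,
    neg_one_pow_complement i j k A₁ A₀ heven, hinv, h11, zero_add, hprod,
    Fin.val_zero, mul_zero]
  ext r
  simp only [Pi.add_apply, Pi.smul_apply, smul_eq_mul]
  rcases hs with rfl | rfl <;> rcases neg_one_pow_eq_or ℂ (x₂ : ℕ) with h | h <;> rw [h] <;> ring
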